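/- The L² adjoint of the Abel-type projection operator H is given by H*g(r,z) = 2 ∫_0^{|r|} g(sgn(r)·u, z) · |r|/√(r²−u²) du; that is, for all f, g ∈ L^∞(ℝ²) with compact support, ∫∫ Hf(u,v) g(u,v) du dv = ∫∫ f(r,z) H*g(r,z) dr dz. -/

import Mathlib

open MeasureTheory Real

/-- `sgn x = 1` if `x ≥ 0`, `−1` if `x < 0`. -/
noncomputable def sgn (x : ℝ) : ℝ := if 0 ≤ x then 1 else -1

/-- The Abel-type projection operator
`Hf(u,v) = 2 ∫_{|u|}^{∞} f(sgn(u)·r, v) r/√(r²−u²) dr`. -/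
noncomputable def Hproj (f : ℝ → ℝ → ℝ) (u v : ℝ) : ℝ :=
  2 * ∫ r in Set.Ioi |u|, f (sgn u * r) v * (r / Real.sqrt (r ^ 2 - u ^ 2))

/-- The back-projection `H*g(r,z) = 2 ∫_0^{|r|} g(sgn(r)·u, z) |r|/√(r²−u²) du`. -/
noncomputable def Hadj (g : ℝ → ℝ → ℝ) (r z : ℝ) : ℝ :=
  2 * ∫ u in Set.Ioc 0 |r|, g (sgn r * u) z * (|r| / Real.sqrt (r ^ 2 - u ^ 2))

/-- The profile `s ↦ 1 / √(1 - s²)` on `(0, 1)`, extended by zero. -/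
noncomputable def abelProfile (s : ℝ) : ℝ := if 0 < s then 1 / √(1 - s ^ 2) else 0

/-- The symmetric-in-sign Abel kernel: `|r| / √(r² - u²)` where `u` and `r` have the same sign
and `|u| < |r|`, and zero elsewhere. -/
noncomputable def abelKernel (u r : ℝ) : ℝ := if 0 < u * r then |r| / √(r ^ 2 - u ^ 2) else 0

lemma abelProfile_nonneg (s : ℝ) : 0 ≤ abelProfile s := by
  unfold abelProfile; split_ifs <;> positivity

lemma abelKernel_nonneg (u r : ℝ) : 0 ≤ abelKernel u r := by
  unfold abelKernel; split_ifs <;> positivity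

lemma measurable_abelKernel : Measurable fun p : ℝ × ℝ => abelKernel p.1 p.2 := by
  unfold abelKernel
  refine Measurable.ite (measurableSet_lt measurable_const (by fun_prop)) ?_ measurable_const
  fun_prop

lemma abelKernel_eq_abelProfile_div (u r : ℝ) : abelKernel u r = abelProfile (u / r) := by
  rcases eq_or_ne r 0 with rfl | hr
  · simp [abelKernel, abelProfile]
  have hsign : 0 < u / r ↔ 0 < u * r := by
    rw [show u / r = u * r / r ^ 2 by field_simp]
    exact div_pos_iff_of_pos_right (by positivity)
  have hsqrt : r ^ 2 - u ^ 2 = r ^ 2 * (1 - (u / r) ^ 2) := by field_simp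
  unfold abelKernel abelProfile
  rw [hsqrt, sqrt_mul (sq_nonneg r), sqrt_sq_eq_abs, ← div_div, div_self (abs_ne_zero.mpr hr)]
  simp only [hsign]

lemma abelKernel_eq_zero_of_abs_le {u r : ℝ} (h : |r| ≤ |u|) : abelKernel u r = 0 := by
  have : √(r ^ 2 - u ^ 2) = 0 := sqrt_eq_zero_of_nonpos (by linarith [sq_le_sq.mpr h])
  simp [abelKernel, this]

lemma integrable_abelProfile : Integrable abelProfile := by
  have h : IntegrableOn (fun s : ℝ => 1 / √(1 - s ^ 2)) (Set.Ioc 0 1) :=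
    intervalIntegral.integrableOn_deriv_of_nonneg continuous_arcsin.continuousOn
      (fun x hx => hasDerivAt_arcsin (by linarith [hx.1]) hx.2.ne) (fun x _ => by positivity)
  refine (h.integrable_indicator measurableSet_Ioc).congr (.of_forall fun s => ?_)
  by_cases h0 : 0 < s <;> by_cases h1 : s ≤ 1 <;>
    simp only [Set.indicator, Set.mem_Ioc, abelProfile, h0, h1, and_true, and_false,
      if_true, if_false]
  rw [sqrt_eq_zero_of_nonpos (by nlinarith), div_zero]

lemma integrable_indicator_mul_abelKernel (R : ℝ) :
    Integrable (fun p : ℝ × ℝ => (Set.Icc (-R) R).indicator 1 p.2 * abelKernel p.1 p.2)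
      (volume.prod volume) := by
  have hmeas : Measurable fun p : ℝ × ℝ =>
      (Set.Icc (-R) R).indicator (1 : ℝ → ℝ) p.2 * abelKernel p.1 p.2 :=
    ((measurable_one.indicator measurableSet_Icc).comp measurable_snd).mul measurable_abelKernel
  rw [integrable_prod_iff' hmeas.aestronglyMeasurable]
  constructor
  · filter_upwards [Measure.ae_ne volume 0] with r hr
    simp only [abelKernel_eq_abelProfile_div]
    exact (integrable_abelProfile.comp_div hr).const_mul _
  · have hint : ∀ r : ℝ, ∫ u, ‖(Set.Icc (-R) R).indicator (1 : ℝ → ℝ) r * abelKernel u r‖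
        = (Set.Icc (-R) R).indicator (fun r => |r| * ∫ s, abelProfile s) r := by
      intro r
      by_cases hr : r ∈ Set.Icc (-R) R
      · simp [hr, abelKernel_eq_abelProfile_div, abs_of_nonneg (abelProfile_nonneg _),
          Measure.integral_comp_div]
      · simp [hr]
    simp only [hint]
    rw [integrable_indicator_iff measurableSet_Icc]
    exact (by fun_prop : Continuous fun r : ℝ => |r| * ∫ s, abelProfile s).integrableOn_Icc

lemma Hproj_eq_integral_abelKernel (f : ℝ → ℝ → ℝ) {u : ℝ} (hu : u ≠ 0) (v : ℝ) :
    Hproj f u v = 2 * ∫ r, f r v * abelKernel u r := by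
  unfold Hproj
  rw [← integral_indicator measurableSet_Ioi]
  rcases hu.lt_or_gt with hu | hu
  · rw [← integral_neg_eq_self (fun r => f r v * abelKernel u r)]
    congr 2 with r
    by_cases hr : |u| < r
    · have hr0 : 0 < r := (abs_nonneg u).trans_lt hr
      simp [hr, sgn, hu.not_ge, abelKernel, mul_neg_of_neg_of_pos hu hr0, abs_of_pos hr0]
    · rw [Set.indicator_of_notMem (by simpa using hr)]
      rcases le_or_gt r 0 with h0 | h0
      · simp [abelKernel, mul_nonneg_of_nonpos_of_nonpos hu.le h0]
      · rw [abelKernel_eq_zero_of_abs_le (by rw [abs_neg, abs_of_pos h0]; exact not_lt.mp hr),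
          mul_zero]
  · congr 2 with r
    by_cases hr : |u| < r
    · have hr0 : 0 < r := (abs_nonneg u).trans_lt hr
      simp [hr, sgn, hu.le, abelKernel, mul_pos hu hr0, abs_of_pos hr0]
    · rw [Set.indicator_of_notMem (by simpa using hr)]
      rcases le_or_gt r 0 with h0 | h0
      · simp [abelKernel, mul_nonpos_of_nonneg_of_nonpos hu.le h0]
      · rw [abelKernel_eq_zero_of_abs_le (by rw [abs_of_pos h0]; exact not_lt.mp hr), mul_zero]

lemma Hadj_eq_integral_abelKernel (g : ℝ → ℝ → ℝ) (r z : ℝ) :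
    Hadj g r z = 2 * ∫ u, g u z * abelKernel u r := by
  unfold Hadj
  rw [← integral_indicator measurableSet_Ioc]
  rcases lt_or_ge r 0 with hr | hr
  · rw [← integral_neg_eq_self (fun u => g u z * abelKernel u r)]
    congr 2 with u
    by_cases hu : u ∈ Set.Ioc 0 |r|
    · simp [hu, sgn, hr.not_ge, abelKernel, mul_neg_of_pos_of_neg hu.1 hr]
    · rw [Set.indicator_of_notMem hu]
      rcases le_or_gt u 0 with h0 | h0
      · simp [abelKernel, mul_nonneg_of_nonpos_of_nonpos h0 hr.le]
      · have : |r| ≤ |-u| := by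
          rw [abs_neg, abs_of_pos h0]
          exact (not_le.mp fun h => hu ⟨h0, h⟩).le
        rw [abelKernel_eq_zero_of_abs_le this, mul_zero]
  · congr 2 with u
    by_cases hu : u ∈ Set.Ioc 0 |r|
    · have hr0 : 0 < r := by simpa [abs_of_nonneg hr] using hu.1.trans_le hu.2
      simp [hu, sgn, hr, abelKernel, mul_pos hu.1 hr0]
    · rw [Set.indicator_of_notMem hu]
      rcases le_or_gt u 0 with h0 | h0
      · simp [abelKernel, mul_nonpos_of_nonpos_of_nonneg h0 hr]
      · have : |r| ≤ |u| := by
          rw [abs_of_pos h0]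
          exact (not_le.mp fun h => hu ⟨h0, h⟩).le
        rw [abelKernel_eq_zero_of_abs_le this, mul_zero]

/-- A bounded function with compact support on the plane is dominated by a multiple of the
indicator function of a square. -/
lemma exists_abs_le_indicator_mul_indicator {f : ℝ → ℝ → ℝ}
    (hfs : HasCompactSupport (Function.uncurry f)) (hfb : ∃ C, ∀ r z, |f r z| ≤ C) :
    ∃ C R : ℝ, ∀ r z, |f r z| ≤
      C * ((Set.Icc (-R) R).indicator 1 r * (Set.Icc (-R) R).indicator 1 z) := by
  obtain ⟨C, hC⟩ := hfb
  obtain ⟨R, hR⟩ := hfs.isCompact.isBounded.exists_norm_le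
  refine ⟨C, R, fun r z => ?_⟩
  by_cases h : f r z = 0
  · rw [h, abs_zero]
    have := (abs_nonneg _).trans (hC 0 0)
    have hi : ∀ x : ℝ, 0 ≤ (Set.Icc (-R) R).indicator (1 : ℝ → ℝ) x :=
      Set.indicator_nonneg fun _ _ => zero_le_one
    exact mul_nonneg this (mul_nonneg (hi r) (hi z))
  · have hn : ‖(r, z)‖ ≤ R := hR _ (subset_tsupport _ h)
    rw [Prod.norm_def, max_le_iff, norm_eq_abs, norm_eq_abs, abs_le, abs_le] at hn
    simpa [Set.indicator_of_mem (Set.mem_Icc.mpr hn.1), Set.indicator_of_mem (Set.mem_Icc.mpr hn.2)]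
      using hC r z

/-- `H*` is the L² adjoint of `H`: for all bounded compactly
supported measurable `f, g`, `∫∫ Hf·g = ∫∫ f·H*g`. -/
theorem adjoint_formula (f g : ℝ → ℝ → ℝ)
    (hfm : Measurable (Function.uncurry f)) (hgm : Measurable (Function.uncurry g))
    (hfs : HasCompactSupport (Function.uncurry f))
    (hgs : HasCompactSupport (Function.uncurry g))
    (hfb : ∃ C, ∀ r z, |f r z| ≤ C) (hgb : ∃ C, ∀ u v, |g u v| ≤ C) :
    ∫ u : ℝ, ∫ v : ℝ, Hproj f u v * g u v = ∫ r : ℝ, ∫ z : ℝ, f r z * Hadj g r z := by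
  obtain ⟨C, R, hC⟩ := exists_abs_le_indicator_mul_indicator hfs hfb
  obtain ⟨D, hD⟩ := hgb
  set χ : ℝ → ℝ := (Set.Icc (-R) R).indicator 1 with hχ
  have hχint : Integrable χ :=
    (integrable_indicator_iff measurableSet_Icc).mpr (integrableOn_const (by simp))
  have hker := integrable_indicator_mul_abelKernel R
  rw [← hχ] at hker
  let F : ℝ → ℝ → ℝ → ℝ := fun u r v => f r v * abelKernel u r * g u v
  have hFm : Measurable fun p : (ℝ × ℝ) × ℝ => F p.1.1 p.1.2 p.2 :=
    ((hfm.comp (by fun_prop : Measurable fun p : (ℝ × ℝ) × ℝ => (p.1.2, p.2))).mul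
      (measurable_abelKernel.comp measurable_fst)).mul
      (hgm.comp (by fun_prop : Measurable fun p : (ℝ × ℝ) × ℝ => (p.1.1, p.2)))
  have hbound : ∀ u r v, ‖F u r v‖ ≤ C * D * (χ r * abelKernel u r * χ v) := by
    intro u r v
    have hK := abelKernel_nonneg u r
    calc ‖F u r v‖ = |f r v| * abelKernel u r * |g u v| := by
          simp [F, abs_of_nonneg hK]
      _ ≤ C * (χ r * χ v) * abelKernel u r * D := by
          have h := hC r v
          have := (abs_nonneg _).trans h
          gcongr
          exact hD u v
      _ = _ := by ring
  have hF : Integrable (fun p : (ℝ × ℝ) × ℝ => F p.1.1 p.1.2 p.2)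
      ((volume.prod volume).prod volume) :=
    ((hker.mul_prod hχint).const_mul (C * D)).mono' hFm.aestronglyMeasurable
      (.of_forall fun p => hbound p.1.1 p.1.2 p.2)
  have hleft : ∀ᵐ u : ℝ, ∫ v, Hproj f u v * g u v = 2 * ∫ r, ∫ v, F u r v := by
    filter_upwards [Measure.ae_ne volume 0, hker.prod_right_ae] with u hu hku
    have hint : Integrable (fun p : ℝ × ℝ => F u p.1 p.2) (volume.prod volume) :=
      ((hku.mul_prod hχint).const_mul (C * D)).mono'
        (hFm.comp (by fun_prop : Measurable fun p : ℝ × ℝ =>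
          ((u, p.1), p.2))).aestronglyMeasurable (.of_forall fun p => hbound u p.1 p.2)
    rw [integral_integral_swap hint, ← integral_const_mul]
    simp only [Hproj_eq_integral_abelKernel f hu, F, mul_assoc]
    simp only [← mul_assoc, integral_mul_const]
  have hright : ∀ᵐ r : ℝ, ∫ z, f r z * Hadj g r z = 2 * ∫ u, ∫ v, F u r v := by
    filter_upwards [hker.prod_left_ae] with r hkr
    have hint : Integrable (fun p : ℝ × ℝ => F p.1 r p.2) (volume.prod volume) :=
      ((hkr.mul_prod hχint).const_mul (C * D)).mono'
        (hFm.comp (by fun_prop : Measurable fun p : ℝ × ℝ =>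
          ((p.1, r), p.2))).aestronglyMeasurable (.of_forall fun p => hbound p.1 r p.2)
    rw [integral_integral_swap hint, ← integral_const_mul]
    congr 1 with z
    rw [Hadj_eq_integral_abelKernel, mul_left_comm, ← integral_const_mul]
    congr 2 with u
    ring
  rw [integral_congr_ae hleft, integral_congr_ae hright, integral_const_mul, integral_const_mul,
    integral_integral_swap hF.integral_prod_left]
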